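/- Cayley–Menger determinant bound: for any n ≥ 1 and any points p₀,…,pₙ ∈ ℝⁿ, the Cayley–Menger matrix D̂ satisfies |det D̂| ≤ r_{n+2}·(2/n)^{2n}·p(T)^{2n}, where r_k denotes the number of derangements (fixed-point-free permutations) of k elements. -/

import Mathlib

open scoped BigOperators

/-- `n×n` matrix whose columns are `p₁ - p₀, …, pₙ - p₀`. -/
noncomputable def simMat {n : ℕ} (p : Fin (n + 1) → EuclideanSpace ℝ (Fin n)) :
    Matrix (Fin n) (Fin n) ℝ :=
  Matrix.of fun i j => (p j.succ - p 0) i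

/-- Half-perimeter: half the sum of all pairwise distances. -/
noncomputable def hperim {n : ℕ} (p : Fin (n + 1) → EuclideanSpace ℝ (Fin n)) : ℝ :=
  (1 / 2) * ∑ ij ∈ Finset.univ.filter
      (fun ij : Fin (n + 1) × Fin (n + 1) => ij.1 < ij.2), dist (p ij.1) (p ij.2)

/-- Volume of the simplex on `p₀,…,pₙ`. -/
noncomputable def svol {n : ℕ} (p : Fin (n + 1) → EuclideanSpace ℝ (Fin n)) : ℝ :=
  |(simMat p).det| / (Nat.factorial n : ℝ)

/-- Strength `σ(T) = vol(T)² / p(T)^{2n-1}` (equal to `0` when `p(T) = 0`). -/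
noncomputable def strength {n : ℕ} (p : Fin (n + 1) → EuclideanSpace ℝ (Fin n)) : ℝ :=
  (svol p) ^ 2 / (hperim p) ^ (2 * n - 1)

/-- Orientation sign of the simplex, in `{-1, 0, 1}`. -/
noncomputable def ssign {n : ℕ} (p : Fin (n + 1) → EuclideanSpace ℝ (Fin n)) : ℝ :=
  Real.sign (simMat p).det

/-- Signed strength `s(T) = sign(T)·σ(T)`. -/
noncomputable def signedStrength {n : ℕ} (p : Fin (n + 1) → EuclideanSpace ℝ (Fin n)) : ℝ :=
  ssign p * strength p

/-- The `(n+2)×(n+2)` Cayley–Menger matrix of points `p₀,…,pₙ`: top row `(0,1,…,1)`,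
left column `(0,1,…,1)ᵀ`, and remaining block with entries `|pᵢ - pⱼ|²`. -/
noncomputable def cayleyMenger {n : ℕ} (p : Fin (n + 1) → EuclideanSpace ℝ (Fin n)) :
    Matrix (Fin (n + 2)) (Fin (n + 2)) ℝ :=
  Matrix.of fun a b =>
    Fin.cases (Fin.cases 0 (fun _ => 1) b)
      (fun a' => Fin.cases 1 (fun b' => dist (p a') (p b') ^ 2) b) a

lemma cm_sum_eq {n : ℕ} (p : Fin (n + 1) → EuclideanSpace ℝ (Fin n)) :
    ∑ i, ∑ j, dist (p i) (p j) = 4 * hperim p := by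
  have h1 : ∑ i, ∑ j, dist (p i) (p j)
      = ∑ ij : Fin (n + 1) × Fin (n + 1), dist (p ij.1) (p ij.2) := by
    rw [Fintype.sum_prod_type]
  have h2 : ∀ ij : Fin (n + 1) × Fin (n + 1), dist (p ij.1) (p ij.2)
      = (if ij.1 < ij.2 then dist (p ij.1) (p ij.2) else 0)
        + (if ij.2 < ij.1 then dist (p ij.2) (p ij.1) else 0) := by
    rintro ⟨i, j⟩
    rcases lt_trichotomy i j with h | h | h
    · simp [h, h.le]
    · simp [h]
    · simp [h, h.le, dist_comm]
  have h3 : ∑ ij : Fin (n + 1) × Fin (n + 1),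
        (if ij.2 < ij.1 then dist (p ij.2) (p ij.1) else 0)
      = ∑ ij : Fin (n + 1) × Fin (n + 1),
        (if ij.1 < ij.2 then dist (p ij.1) (p ij.2) else 0) :=
    Fintype.sum_equiv (Equiv.prodComm _ _) _ _ (fun _ => rfl)
  rw [h1, Finset.sum_congr rfl (fun ij _ => h2 ij), Finset.sum_add_distrib, h3, hperim,
    Finset.sum_filter]
  ring

lemma cm_dist_le {n : ℕ} (p : Fin (n + 1) → EuclideanSpace ℝ (Fin n))
    (a b : Fin (n + 1)) (hab : a ≠ b) : n * dist (p a) (p b) ≤ 2 * hperim p := by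
  have hR : ∀ k, dist (p a) (p b) ≤ ∑ j, dist (p k) (p j) := by
    intro k
    calc dist (p a) (p b) ≤ dist (p k) (p a) + dist (p k) (p b) := by
          rw [dist_comm (p k) (p a)]; exact dist_triangle _ _ _
      _ = ∑ j ∈ {a, b}, dist (p k) (p j) := by rw [Finset.sum_pair hab]
      _ ≤ _ := Finset.sum_le_sum_of_subset_of_nonneg (Finset.subset_univ _)
          (fun _ _ _ => dist_nonneg)
  have hab2 : ((n : ℝ) + 1) * dist (p a) (p b)
      ≤ ∑ j, dist (p a) (p j) + ∑ j, dist (p b) (p j) := by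
    rw [← Finset.sum_add_distrib]
    calc ((n : ℝ) + 1) * dist (p a) (p b) = ∑ j : Fin (n + 1), dist (p a) (p b) := by simp
      _ ≤ _ := Finset.sum_le_sum (fun j _ => dist_triangle_right _ _ _)
  have hS := cm_sum_eq p
  have hc : (({a, b} : Finset (Fin (n + 1)))ᶜ.card : ℝ) = n - 1 := by
    have h := Finset.card_add_card_compl ({a, b} : Finset (Fin (n + 1)))
    rw [Finset.card_pair hab, Fintype.card_fin] at h
    have h' : (2 : ℝ) + (({a, b} : Finset (Fin (n + 1)))ᶜ.card : ℝ) = n + 1 := by exact_mod_cast h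
    linarith
  have hrest : ((n : ℝ) - 1) * dist (p a) (p b)
      ≤ ∑ k ∈ ({a, b} : Finset (Fin (n + 1)))ᶜ, ∑ j, dist (p k) (p j) := by
    rw [← hc, ← nsmul_eq_mul]
    exact Finset.card_nsmul_le_sum _ _ _ (fun k _ => hR k)
  rw [← Finset.sum_add_sum_compl ({a, b} : Finset (Fin (n + 1))), Finset.sum_pair hab] at hS
  linarith

lemma cm_hperim_nonneg {n : ℕ} (p : Fin (n + 1) → EuclideanSpace ℝ (Fin n)) :
    0 ≤ hperim p := by
  unfold hperim
  exact mul_nonneg (by norm_num) (Finset.sum_nonneg (fun _ _ => dist_nonneg))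

lemma cm_prod_le {n : ℕ} (hn : 1 ≤ n) (p : Fin (n + 1) → EuclideanSpace ℝ (Fin n))
    (σ : Equiv.Perm (Fin (n + 2))) (hσ : σ ∈ derangements (Fin (n + 2))) :
    ∏ i, |cayleyMenger p (σ i) i| ≤ (2 / (n : ℝ) * hperim p) ^ (2 * n) := by
  set M := 2 / (n : ℝ) * hperim p with hM
  have hn0 : (0 : ℝ) < n := by exact_mod_cast hn
  have hM0 : 0 ≤ M := mul_nonneg (by positivity) (cm_hperim_nonneg p)
  have hd : ∀ a b, dist (p a) (p b) ≤ M := by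
    intro a b
    by_cases hab : a = b
    · simpa [hab] using hM0
    · have := cm_dist_le p a b hab
      rw [hM, div_mul_eq_mul_div, le_div_iff₀ hn0]
      linarith
  have hne : (0 : Fin (n + 2)) ≠ σ.symm 0 := by
    intro h
    apply hσ 0
    have := congrArg σ h
    simpa using this
  have hle : ∀ i, |cayleyMenger p (σ i) i|
      ≤ if i ∈ ({0, σ.symm 0} : Finset (Fin (n + 2)))ᶜ then M ^ 2 else 1 := by
    intro i
    have key : ∀ a b : Fin (n + 2), |cayleyMenger p a b| ≤ if a ≠ 0 ∧ b ≠ 0 then M ^ 2 else 1 := by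
      intro a b
      refine Fin.cases ?_ (fun a' => ?_) a <;> refine Fin.cases ?_ (fun b' => ?_) b
      · simp [cayleyMenger]
      · simp [cayleyMenger]
      · simp [cayleyMenger]
      · have : dist (p a') (p b') ^ 2 ≤ M ^ 2 := pow_le_pow_left₀ dist_nonneg (hd _ _) 2
        simpa [cayleyMenger] using this
    refine (key (σ i) i).trans (le_of_eq ?_)
    congr 1
    simp [Equiv.eq_symm_apply, and_comm]
  have hc : ({0, σ.symm 0} : Finset (Fin (n + 2)))ᶜ.card = n := by
    rw [Finset.card_compl, Finset.card_pair hne, Fintype.card_fin]; omega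
  calc ∏ i, |cayleyMenger p (σ i) i|
      ≤ ∏ i, (if i ∈ ({0, σ.symm 0} : Finset (Fin (n + 2)))ᶜ then M ^ 2 else 1) :=
        Finset.prod_le_prod (fun _ _ => abs_nonneg _) (fun i _ => hle i)
    _ = M ^ (2 * n) := by
        rw [Finset.prod_ite_mem, Finset.univ_inter, Finset.prod_const, hc, pow_mul]

lemma cm_diag {n : ℕ} (p : Fin (n + 1) → EuclideanSpace ℝ (Fin n)) (i : Fin (n + 2)) :
    cayleyMenger p i i = 0 := by
  refine Fin.cases ?_ (fun a => ?_) i <;> simp [cayleyMenger]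

/-- Cayley–Menger determinant bound
`|det D̂| ≤ r_{n+2}·(2/n)^{2n}·p(T)^{2n}` where `r_k` is the number of derangements. -/
theorem cayleyMenger_det_bound (n : ℕ) (hn : 1 ≤ n)
    (p : Fin (n + 1) → EuclideanSpace ℝ (Fin n)) :
    |(cayleyMenger p).det| ≤
      (numDerangements (n + 2) : ℝ) * (2 / (n : ℝ)) ^ (2 * n) * (hperim p) ^ (2 * n) := by
  classical
  have habs : |(cayleyMenger p).det| ≤ ∑ σ : Equiv.Perm (Fin (n + 2)),
      ∏ i, |cayleyMenger p (σ i) i| := by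
    rw [Matrix.det_apply']
    refine (Finset.abs_sum_le_sum_abs _ _).trans (Finset.sum_le_sum fun σ _ => ?_)
    rw [abs_mul, Finset.abs_prod]
    rcases Int.units_eq_one_or (Equiv.Perm.sign σ) with h | h <;> simp [h]
  refine habs.trans ?_
  rw [mul_assoc, ← mul_pow]
  calc ∑ σ : Equiv.Perm (Fin (n + 2)), ∏ i, |cayleyMenger p (σ i) i|
      ≤ ∑ σ : Equiv.Perm (Fin (n + 2)),
        if σ ∈ derangements (Fin (n + 2)) then (2 / (n : ℝ) * hperim p) ^ (2 * n) else 0 := by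
        refine Finset.sum_le_sum fun σ _ => ?_
        split_ifs with h
        · exact cm_prod_le hn p σ h
        · have h' : ∃ i, σ i = i := by
            by_contra hcon
            exact h (fun i hi => hcon ⟨i, hi⟩)
          obtain ⟨i, hi⟩ := h'
          exact (Finset.prod_eq_zero (Finset.mem_univ i) (by rw [hi, cm_diag, abs_zero])).le
    _ = _ := by
        rw [← Finset.sum_filter, Finset.sum_const, nsmul_eq_mul, ← Fintype.card_subtype]
        congr 2
        have := card_derangements_eq_numDerangements (Fin (n + 2))
        rw [Fintype.card_fin] at this
        rw [← this]
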